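/- Let Ψ : ℳ → ℳ be multiplicative and degree-preserving, with Ψ[p] ∈ 𝒫 for every p ∈ 𝒫, and suppose the restriction of Ψ to 𝒫 is support-preserving and that Ψ[(X+1)/2] = (X+1)/2. Then for every a ∈ [−1,1], Ψ[(X²−aX+1)/(2−a)] = (X²−aX+1)/(2−a). -/

import Mathlib

open Polynomial

/-- `Pset` is the set of real polynomials with nonnegative coefficients summing to 1. -/
def Pset : Set (Polynomial ℝ) := {p | (∀ k, 0 ≤ p.coeff k) ∧ p.eval 1 = 1}

/-- `Mset` is the set of real polynomials `p` with `p(1) = 1` that are positive on the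
positive reals. -/
def Mset : Set (Polynomial ℝ) := {p | p.eval 1 = 1 ∧ ∀ x : ℝ, 0 < x → 0 < p.eval x}

/-- The normalized linear polynomial `(X + a)/(1 + a)`. -/
noncomputable def lin (a : ℝ) : Polynomial ℝ := C (1 + a)⁻¹ * (X + C a)

/-- The normalized self-reciprocal quadratic `(X² - aX + 1)/(2 - a)`. -/
noncomputable def quad (a : ℝ) : Polynomial ℝ := C (2 - a)⁻¹ * (X ^ 2 - C a * X + 1)

lemma quad_mem_Mset {a : ℝ} (ha : a ∈ Set.Icc (-1 : ℝ) 1) : quad a ∈ Mset := by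
  obtain ⟨h1, h2⟩ := ha
  have h : 0 < 2 - a := by linarith
  refine ⟨?_, fun x hx => ?_⟩
  · simp only [quad, eval_mul, eval_C, eval_add, eval_sub, eval_pow, eval_X, eval_one]
    field_simp
    ring
  · simp only [quad, eval_mul, eval_C, eval_add, eval_sub, eval_pow, eval_X, eval_one]
    have : 0 < x ^ 2 - a * x + 1 := by nlinarith [sq_nonneg (x - 1)]
    positivity

lemma lin_one_mem_Mset : lin 1 ∈ Mset := by
  refine ⟨by norm_num [lin], fun x hx => ?_⟩
  simp only [lin, eval_mul, eval_C, eval_add, eval_X]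
  positivity

lemma mul_mem_Mset {p q : Polynomial ℝ} (hp : p ∈ Mset) (hq : q ∈ Mset) : p * q ∈ Mset := by
  refine ⟨by simp [hp.1, hq.1], fun x hx => ?_⟩
  rw [eval_mul]
  exact mul_pos (hp.2 x hx) (hq.2 x hx)

/-- A monotone solution of Cauchy's equation on `[0, 1]`, extended oddly to `[-1, 1]`. -/
lemma eq_self_of_additive {h : ℝ → ℝ}
    (hodd : ∀ a ∈ Set.Icc (-1 : ℝ) 1, h a + h (-a) = 0)
    (hneg : ∀ a ∈ Set.Icc (-1 : ℝ) 1, ∀ b ∈ Set.Icc (-1 : ℝ) 1, a + b < 0 → h a + h b < 0)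
    (hadd : ∀ a b : ℝ, 0 ≤ a → 0 ≤ b → a + b ≤ 1 → h a + h b + h (-(a + b)) = 0)
    (hone : h 1 = 1) {a : ℝ} (ha : a ∈ Set.Icc (-1 : ℝ) 1) : h a = a := by
  have hzero : h 0 = 0 := by
    have := hodd 0 (by norm_num)
    rw [neg_zero] at this
    linarith
  have hmono : ∀ a b : ℝ, 0 ≤ a → a < b → b ≤ 1 → h a < h b := fun a b h0 hab h1 => by
    have hb := hodd b ⟨by linarith, h1⟩
    have := hneg a ⟨by linarith, by linarith⟩ (-b) ⟨by linarith, by linarith⟩ (by linarith)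
    linarith
  have hsum : ∀ a b : ℝ, 0 ≤ a → 0 ≤ b → a + b ≤ 1 → h (a + b) = h a + h b :=
    fun a b h0 h1 h2 => by
      linarith [hadd a b h0 h1 h2, hodd (a + b) ⟨by linarith, h2⟩]
  have hmul : ∀ (n : ℕ) (x : ℝ), 0 ≤ x → n * x ≤ 1 → h (n * x) = n * h x := fun n x hx => by
    induction n with
    | zero => simp [hzero]
    | succ n ih =>
      intro hn
      push_cast at hn ⊢
      rw [add_mul, one_mul] at hn ⊢
      rw [hsum _ _ (by positivity) hx hn, ih (by linarith)]
      ring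
  have hrat : ∀ r : ℚ, 0 < (r : ℝ) → (r : ℝ) < 1 → h r = r := fun r h0 h1 => by
    have hd : (0 : ℝ) < r.den := by exact_mod_cast r.pos
    have hr : ((r.num.toNat : ℕ) : ℝ) * (r.den : ℝ)⁻¹ = r := by
      have h2 : ((r.num.toNat : ℤ) : ℝ) = (r.num : ℝ) := by
        rw [Int.toNat_of_nonneg (Rat.num_nonneg.2 (by exact_mod_cast h0.le))]
      rw [Int.cast_natCast] at h2
      rw [h2, ← div_eq_mul_inv]
      exact_mod_cast Rat.num_div_den r
    have h3 := hmul r.den (r.den : ℝ)⁻¹ (by positivity) (by rw [mul_inv_cancel₀ hd.ne'])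
    rw [mul_inv_cancel₀ hd.ne', hone] at h3
    have h4 := hmul r.num.toNat (r.den : ℝ)⁻¹ (by positivity) (by rw [hr]; exact h1.le)
    rwa [hr, eq_inv_of_mul_eq_one_right h3.symm, hr] at h4
  have hpos : ∀ a : ℝ, 0 < a → a < 1 → h a = a := fun a h0 h1 => by
    have ha0 := hmono 0 a le_rfl h0 h1.le
    have ha1 := hmono a 1 h0.le h1 le_rfl
    rcases lt_trichotomy (h a) a with hlt | heq | hlt
    · obtain ⟨r, hr, hr'⟩ := exists_rat_btwn hlt
      have := hmono r a (by linarith) hr' h1.le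
      rw [hrat r (by linarith) (by linarith)] at this
      linarith
    · exact heq
    · obtain ⟨r, hr, hr'⟩ := exists_rat_btwn hlt
      have := hmono a r h0.le hr (by linarith)
      rw [hrat r (by linarith) (by linarith)] at this
      linarith
  have hnonneg : ∀ a : ℝ, 0 ≤ a → a ≤ 1 → h a = a := fun a h0 h1 => by
    rcases h0.eq_or_lt with rfl | h0
    · exact hzero
    rcases h1.eq_or_lt with rfl | h1
    · exact hone
    exact hpos a h0 h1
  rcases le_total 0 a with h0 | h0
  · exact hnonneg a h0 ha.2
  · linarith [hnonneg (-a) (by linarith) (by linarith [ha.1]), hodd a ha]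

lemma quad_mul_quad (a b : ℝ) : quad a * quad b = C ((2 - a)⁻¹ * (2 - b)⁻¹) *
    (X ^ 4 + C (-(a + b)) * X ^ 3 + C (2 + a * b) * X ^ 2 + C (-(a + b)) * X + C 1) := by
  simp only [quad, map_mul, map_add, map_neg, map_one, map_ofNat]
  ring

lemma lin_mul_quad (a : ℝ) : lin 1 * quad a = C (2⁻¹ * (2 - a)⁻¹) *
    (X ^ 3 + C (1 - a) * X ^ 2 + C (1 - a) * X + C 1) := by
  simp only [quad, lin, map_mul, map_sub, map_one, one_add_one_eq_two]
  ring

lemma quad_mul_quad_mul_quad {a b c : ℝ} (h : a + b + c = 0) :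
    quad a * quad b * quad c = C ((2 - a)⁻¹ * (2 - b)⁻¹ * (2 - c)⁻¹) *
    (X ^ 6 + C (3 - (a ^ 2 + a * b + b ^ 2)) * X ^ 4 + C (a * b * (a + b)) * X ^ 3 +
      C (3 - (a ^ 2 + a * b + b ^ 2)) * X ^ 2 + C 1) := by
  obtain rfl : c = -(a + b) := by linarith
  simp only [quad, map_mul, map_add, map_sub, map_neg, map_one, map_ofNat, map_pow]
  ring

lemma coeff_lin_mul_quad (a : ℝ) (k : ℕ) : (lin 1 * quad a).coeff k = 2⁻¹ * (2 - a)⁻¹ *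
    (if k = 0 then 1 else if k = 1 then 1 - a else if k = 2 then 1 - a else
      if k = 3 then 1 else 0) := by
  rw [lin_mul_quad, coeff_C_mul]
  congr 1
  rcases k with _ | _ | _ | _ | k <;>
    simp only [coeff_add, coeff_C_mul, coeff_C, coeff_X, coeff_X_pow] <;> simp

lemma coeff_quad_mul_quad (a b : ℝ) (k : ℕ) : (quad a * quad b).coeff k =
    (2 - a)⁻¹ * (2 - b)⁻¹ *
    (if k = 0 then 1 else if k = 1 then -(a + b) else if k = 2 then 2 + a * b else
      if k = 3 then -(a + b) else if k = 4 then 1 else 0) := by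
  rw [quad_mul_quad, coeff_C_mul]
  congr 1
  rcases k with _ | _ | _ | _ | _ | k <;>
    simp only [coeff_add, coeff_C_mul, coeff_C, coeff_X, coeff_X_pow] <;> simp

lemma coeff_quad_mul_quad_mul_quad {a b c : ℝ} (h : a + b + c = 0) (k : ℕ) :
    (quad a * quad b * quad c).coeff k = (2 - a)⁻¹ * (2 - b)⁻¹ * (2 - c)⁻¹ *
    (if k = 0 then 1 else if k = 2 then 3 - (a ^ 2 + a * b + b ^ 2) else
      if k = 3 then a * b * (a + b) else if k = 4 then 3 - (a ^ 2 + a * b + b ^ 2) else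
      if k = 6 then 1 else 0) := by
  rw [quad_mul_quad_mul_quad h, coeff_C_mul]
  congr 1
  rcases k with _ | _ | _ | _ | _ | _ | _ | k <;>
    simp only [coeff_add, coeff_C_mul, coeff_C, coeff_X_pow] <;> simp

lemma lin_mul_quad_mem_Pset {a : ℝ} (ha : a ∈ Set.Icc (-1 : ℝ) 1) : lin 1 * quad a ∈ Pset := by
  refine ⟨fun k => ?_, (mul_mem_Mset lin_one_mem_Mset (quad_mem_Mset ha)).1⟩
  have h1 : 0 < 2 - a := by linarith [ha.2]
  have h2 : 0 ≤ 1 - a := by linarith [ha.2]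
  rw [coeff_lin_mul_quad]
  split_ifs <;> positivity

lemma quad_mul_quad_mem_Pset {a b : ℝ} (ha : a ∈ Set.Icc (-1 : ℝ) 1)
    (hb : b ∈ Set.Icc (-1 : ℝ) 1) (hab : a + b ≤ 0) : quad a * quad b ∈ Pset := by
  refine ⟨fun k => ?_, (mul_mem_Mset (quad_mem_Mset ha) (quad_mem_Mset hb)).1⟩
  have h1 : 0 < 2 - a := by linarith [ha.2]
  have h2 : 0 < 2 - b := by linarith [hb.2]
  have h3 : 0 ≤ -(a + b) := by linarith
  have h4 : 0 ≤ 2 + a * b := by nlinarith [ha.1, ha.2, hb.1, hb.2]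
  rw [coeff_quad_mul_quad]
  split_ifs <;> positivity

lemma quad_mul_quad_mul_quad_mem_Pset {a b : ℝ} (ha : 0 ≤ a) (hb : 0 ≤ b) (hab : a + b ≤ 1) :
    quad a * quad b * quad (-(a + b)) ∈ Pset := by
  refine ⟨fun k => ?_, (mul_mem_Mset (mul_mem_Mset (quad_mem_Mset ⟨by linarith, by linarith⟩)
    (quad_mem_Mset ⟨by linarith, by linarith⟩)) (quad_mem_Mset ⟨by linarith, by linarith⟩)).1⟩
  have h1 : 0 < 2 - a := by linarith
  have h2 : 0 < 2 - b := by linarith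
  have h3 : 0 < 2 - -(a + b) := by linarith
  have h4 : 0 ≤ 3 - (a ^ 2 + a * b + b ^ 2) := by nlinarith
  rw [coeff_quad_mul_quad_mul_quad (by ring)]
  split_ifs <;> positivity

section
variable {p q r : Polynomial ℝ} {j : ℕ}

lemma coeff_lin_mul (hp : p.degree ≤ 2) (hj : j = 0 ∨ j = 2) :
    (lin 1 * p).coeff (j + j / 2) = 2⁻¹ * p.coeff j := by
  have h3 : p.coeff 3 = 0 := coeff_eq_zero_of_degree_lt (hp.trans_lt (by norm_num))
  rcases hj with rfl | rfl <;>
    simp [lin, mul_assoc, add_mul, coeff_X_mul, one_add_one_eq_two, h3]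

lemma coeff_lin_mul_middle (hj : j = 0 ∨ j = 2) :
    (lin 1 * p).coeff (j / 2 + 1) = 2⁻¹ * (p.coeff 1 + p.coeff j) := by
  have h : (X * p).coeff 2 = p.coeff 1 := coeff_X_mul p 1
  rcases hj with rfl | rfl <;>
    simp [lin, mul_assoc, add_mul, coeff_X_mul, h, one_add_one_eq_two, add_comm]

lemma coeff_mul_succ (hp : p.degree ≤ 2) (hq : q.degree ≤ 2) (hj : j = 0 ∨ j = 2) :
    (p * q).coeff (j + 1) = p.coeff j * q.coeff 1 + p.coeff 1 * q.coeff j := by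
  have hp3 : p.coeff 3 = 0 := coeff_eq_zero_of_degree_lt (hp.trans_lt (by norm_num))
  have hq3 : q.coeff 3 = 0 := coeff_eq_zero_of_degree_lt (hq.trans_lt (by norm_num))
  rw [coeff_mul, Finset.Nat.sum_antidiagonal_eq_sum_range_succ_mk]
  rcases hj with rfl | rfl <;> simp [Finset.sum_range_succ, hp3, hq3, add_comm]

lemma coeff_mul_mul_succ (hp : p.degree ≤ 2) (hq : q.degree ≤ 2) (hr : r.degree ≤ 2)
    (hj : j = 0 ∨ j = 2) : (p * q * r).coeff (2 * j + 1) =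
      p.coeff j * q.coeff j * r.coeff 1 + p.coeff j * q.coeff 1 * r.coeff j +
        p.coeff 1 * q.coeff j * r.coeff j := by
  have hzero : ∀ {s : Polynomial ℝ} (_ : s.degree ≤ 2) (k : ℕ), s.coeff (k + 3) = 0 :=
    fun hs k => coeff_eq_zero_of_degree_lt (hs.trans_lt (by exact_mod_cast (by omega : 2 < k + 3)))
  simp only [coeff_mul, Finset.Nat.sum_antidiagonal_eq_sum_range_succ_mk]
  rcases hj with rfl | rfl <;> simp [Finset.sum_range_succ, hzero hp, hzero hq, hzero hr] <;> ring
end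

lemma degree_quad {a : ℝ} (ha : a ∈ Set.Icc (-1 : ℝ) 1) : (quad a).degree = 2 := by
  have h : (2 - a)⁻¹ ≠ 0 := inv_ne_zero (by linarith [ha.2])
  rw [quad, degree_C_mul h]
  have := degree_quadratic (R := ℝ) (b := -a) (c := 1) one_ne_zero
  simpa [sub_eq_add_neg] using this

/-- Multiplicative maps preserving degrees and, on `Pset`, supports, and fixing `(X + 1)/2`. -/
structure IsSupportPreserving (Ψ : Polynomial ℝ → Polynomial ℝ) : Prop where
  map_mul : ∀ p ∈ Mset, ∀ q ∈ Mset, Ψ (p * q) = Ψ p * Ψ q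
  degree_map : ∀ q ∈ Mset, (Ψ q).degree = q.degree
  map_mem : ∀ p ∈ Pset, Ψ p ∈ Pset
  coeff_pos_iff : ∀ p ∈ Pset, ∀ k : ℕ, 0 < (Ψ p).coeff k ↔ 0 < p.coeff k
  map_lin : Ψ (lin 1) = lin 1
  map_Mset : ∀ q ∈ Mset, Ψ q ∈ Mset

namespace IsSupportPreserving
variable {Ψ : Polynomial ℝ → Polynomial ℝ}

lemma coeff_eq_zero_iff (hΨ : IsSupportPreserving Ψ) {p : Polynomial ℝ} (hp : p ∈ Pset) (k : ℕ) :
    (Ψ p).coeff k = 0 ↔ p.coeff k = 0 := by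
  rw [← not_iff_not, ← ne_eq, ← ne_eq, ← ((hΨ.map_mem p hp).1 k).lt_iff_ne', ← (hp.1 k).lt_iff_ne',
    hΨ.coeff_pos_iff p hp k]

lemma degree_map_quad (hΨ : IsSupportPreserving Ψ) {a : ℝ} (ha : a ∈ Set.Icc (-1 : ℝ) 1) :
    (Ψ (quad a)).degree ≤ 2 :=
  ((hΨ.degree_map _ (quad_mem_Mset ha)).trans (degree_quad ha)).le

lemma map_lin_mul_quad (hΨ : IsSupportPreserving Ψ) {a : ℝ} (ha : a ∈ Set.Icc (-1 : ℝ) 1) :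
    Ψ (lin 1 * quad a) = lin 1 * Ψ (quad a) := by
  rw [hΨ.map_mul _ lin_one_mem_Mset _ (quad_mem_Mset ha), hΨ.map_lin]

/-- The outer coefficients of the image of `quad a` are positive. -/
lemma coeff_map_quad_pos (hΨ : IsSupportPreserving Ψ) {a : ℝ} (ha : a ∈ Set.Icc (-1 : ℝ) 1)
    {j : ℕ} (hj : j = 0 ∨ j = 2) : 0 < (Ψ (quad a)).coeff j := by
  have h := (hΨ.coeff_pos_iff _ (lin_mul_quad_mem_Pset ha) (j + j / 2)).2 (by
    have h1 : 0 < 2 - a := by linarith [ha.2]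
    rw [coeff_lin_mul_quad]
    rcases hj with rfl | rfl <;> simp [h1])
  rw [hΨ.map_lin_mul_quad ha, coeff_lin_mul (hΨ.degree_map_quad ha) hj] at h
  linarith

/-- The middle coefficient of the image of `quad a`, relative to an outer coefficient, is `-a`. -/
lemma neg_coeff_one_div_coeff (hΨ : IsSupportPreserving Ψ) {j : ℕ} (hj : j = 0 ∨ j = 2) {a : ℝ}
    (ha : a ∈ Set.Icc (-1 : ℝ) 1) :
    -(Ψ (quad a)).coeff 1 / (Ψ (quad a)).coeff j = a := by
  refine eq_self_of_additive (h := fun a => -(Ψ (quad a)).coeff 1 / (Ψ (quad a)).coeff j)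
    (fun a ha => ?_) (fun a ha b hb hab => ?_) (fun a b ha hb hab => ?_) ?_ ha
  · have hb : -a ∈ Set.Icc (-1 : ℝ) 1 := ⟨by linarith [ha.2], by linarith [ha.1]⟩
    have h := (hΨ.coeff_eq_zero_iff (quad_mul_quad_mem_Pset ha hb (by linarith)) (j + 1)).2 (by
      rw [coeff_quad_mul_quad]
      rcases hj with rfl | rfl <;> simp)
    rw [hΨ.map_mul _ (quad_mem_Mset ha) _ (quad_mem_Mset hb),
      coeff_mul_succ (hΨ.degree_map_quad ha) (hΨ.degree_map_quad hb) hj] at h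
    have h1 := hΨ.coeff_map_quad_pos ha hj
    have h2 := hΨ.coeff_map_quad_pos hb hj
    rw [div_add_div _ _ h1.ne' h2.ne', div_eq_zero_iff]
    left
    linarith
  · have h := (hΨ.coeff_pos_iff _ (quad_mul_quad_mem_Pset ha hb hab.le) (j + 1)).2 (by
      have h1 : 0 < 2 - a := by linarith [ha.2]
      have h2 : 0 < 2 - b := by linarith [hb.2]
      have h3 : 0 < -(a + b) := by linarith
      rw [coeff_quad_mul_quad]
      refine mul_pos (by positivity) ?_
      rcases hj with rfl | rfl <;> simpa using h3)
    rw [hΨ.map_mul _ (quad_mem_Mset ha) _ (quad_mem_Mset hb),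
      coeff_mul_succ (hΨ.degree_map_quad ha) (hΨ.degree_map_quad hb) hj] at h
    have h1 := hΨ.coeff_map_quad_pos ha hj
    have h2 := hΨ.coeff_map_quad_pos hb hj
    rw [div_add_div _ _ h1.ne' h2.ne']
    exact div_neg_of_neg_of_pos (by linarith) (mul_pos h1 h2)
  · have ha' : a ∈ Set.Icc (-1 : ℝ) 1 := ⟨by linarith, by linarith⟩
    have hb' : b ∈ Set.Icc (-1 : ℝ) 1 := ⟨by linarith, by linarith⟩
    have hc : -(a + b) ∈ Set.Icc (-1 : ℝ) 1 := ⟨by linarith, by linarith⟩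
    have h := (hΨ.coeff_eq_zero_iff (quad_mul_quad_mul_quad_mem_Pset ha hb hab) (2 * j + 1)).2 (by
      rw [coeff_quad_mul_quad_mul_quad (by ring)]
      rcases hj with rfl | rfl <;> simp)
    rw [hΨ.map_mul _ (mul_mem_Mset (quad_mem_Mset ha') (quad_mem_Mset hb')) _ (quad_mem_Mset hc),
      hΨ.map_mul _ (quad_mem_Mset ha') _ (quad_mem_Mset hb'),
      coeff_mul_mul_succ (hΨ.degree_map_quad ha') (hΨ.degree_map_quad hb')
        (hΨ.degree_map_quad hc) hj] at h
    have h1 := hΨ.coeff_map_quad_pos ha' hj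
    have h2 := hΨ.coeff_map_quad_pos hb' hj
    have h3 := hΨ.coeff_map_quad_pos hc hj
    rw [div_add_div _ _ h1.ne' h2.ne', div_add_div _ _ (mul_pos h1 h2).ne' h3.ne', div_eq_zero_iff]
    left
    linarith
  · have ha : (1 : ℝ) ∈ Set.Icc (-1 : ℝ) 1 := by norm_num
    have h := (hΨ.coeff_eq_zero_iff (lin_mul_quad_mem_Pset ha) (j / 2 + 1)).2 (by
      rw [coeff_lin_mul_quad]
      rcases hj with rfl | rfl <;> simp)
    rw [hΨ.map_lin_mul_quad ha, coeff_lin_mul_middle hj] at h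
    rw [div_eq_one_iff_eq (hΨ.coeff_map_quad_pos ha hj).ne']
    linarith

lemma coeff_one_map_quad (hΨ : IsSupportPreserving Ψ) {j : ℕ} (hj : j = 0 ∨ j = 2) {a : ℝ}
    (ha : a ∈ Set.Icc (-1 : ℝ) 1) :
    (Ψ (quad a)).coeff 1 = -a * (Ψ (quad a)).coeff j := by
  have h := hΨ.neg_coeff_one_div_coeff hj ha
  rw [div_eq_iff (hΨ.coeff_map_quad_pos ha hj).ne'] at h
  linarith

lemma map_quad_of_coeff_eq (hΨ : IsSupportPreserving Ψ) {a : ℝ} (ha : a ∈ Set.Icc (-1 : ℝ) 1)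
    (h : (Ψ (quad a)).coeff 0 = (Ψ (quad a)).coeff 2) : Ψ (quad a) = quad a := by
  have hq := eq_quadratic_of_degree_le_two (hΨ.degree_map_quad ha)
  rw [h, hΨ.coeff_one_map_quad (.inr rfl) ha] at hq
  have h1 := (hΨ.map_Mset _ (quad_mem_Mset ha)).1
  rw [hq] at h1
  simp only [eval_add, eval_mul, eval_C, eval_pow, eval_X] at h1
  have h2 : (Ψ (quad a)).coeff 2 = (2 - a)⁻¹ := eq_inv_of_mul_eq_one_left (by linarith)
  rw [hq, h2, quad]
  simp only [C_mul, C_neg]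
  ring

lemma map_quad_of_ne_zero (hΨ : IsSupportPreserving Ψ) {a : ℝ} (ha : a ∈ Set.Icc (-1 : ℝ) 1)
    (h : a ≠ 0) : Ψ (quad a) = quad a :=
  hΨ.map_quad_of_coeff_eq ha (mul_left_cancel₀ (neg_ne_zero.2 h)
    ((hΨ.coeff_one_map_quad (.inl rfl) ha).symm.trans (hΨ.coeff_one_map_quad (.inr rfl) ha)))

end IsSupportPreserving

/-- A product of three quadratics whose product with `X ^ 2 + 1` has nonnegative coefficients and
vanishing third coefficient, although its own first and third coefficients do not vanish. -/
noncomputable def auxProd : Polynomial ℝ := quad (-1 / 2) * quad (-1 / 2) * quad (12 / 13)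

lemma auxProd_eq : auxProd = C (26 / 175) *
    (X ^ 6 + C (1 / 13) * X ^ 5 + C (121 / 52) * X ^ 4 + C (-1 / 13) * X ^ 3 +
      C (121 / 52) * X ^ 2 + C (1 / 13) * X + C 1) := by
  refine Polynomial.funext fun x => ?_
  simp only [auxProd, quad, eval_mul, eval_add, eval_sub, eval_pow, eval_C, eval_X, eval_one]
  ring

lemma quad_zero_mul_auxProd : quad 0 * auxProd = C (13 / 175) *
    (X ^ 8 + C (1 / 13) * X ^ 7 + C (173 / 52) * X ^ 6 + C (121 / 26) * X ^ 4 +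
      C (173 / 52) * X ^ 2 + C (1 / 13) * X + C 1) := by
  refine Polynomial.funext fun x => ?_
  simp only [auxProd_eq, quad, eval_mul, eval_add, eval_sub, eval_pow, eval_C, eval_X, eval_one]
  ring

lemma auxProd_mem_Mset : auxProd ∈ Mset :=
  have h := quad_mem_Mset (a := -1 / 2) (by norm_num)
  mul_mem_Mset (mul_mem_Mset h h) (quad_mem_Mset (by norm_num))

lemma quad_zero_mul_auxProd_mem_Pset : quad 0 * auxProd ∈ Pset := by
  refine ⟨fun k => ?_, (mul_mem_Mset (quad_mem_Mset (by norm_num)) auxProd_mem_Mset).1⟩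
  rw [quad_zero_mul_auxProd]
  simp only [coeff_add, coeff_C_mul, coeff_C, coeff_X, coeff_X_pow]
  positivity

namespace IsSupportPreserving
variable {Ψ : Polynomial ℝ → Polynomial ℝ}

lemma map_auxProd (hΨ : IsSupportPreserving Ψ) : Ψ auxProd = auxProd := by
  have h1 : (-1 / 2 : ℝ) ∈ Set.Icc (-1 : ℝ) 1 := by norm_num
  have h2 : (12 / 13 : ℝ) ∈ Set.Icc (-1 : ℝ) 1 := by norm_num
  have h := quad_mem_Mset h1
  rw [auxProd, hΨ.map_mul _ (mul_mem_Mset h h) _ (quad_mem_Mset h2), hΨ.map_mul _ h _ h,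
    hΨ.map_quad_of_ne_zero h1 (by norm_num), hΨ.map_quad_of_ne_zero h2 (by norm_num)]

lemma map_quad_zero (hΨ : IsSupportPreserving Ψ) : Ψ (quad 0) = quad 0 := by
  have h0 : (0 : ℝ) ∈ Set.Icc (-1 : ℝ) 1 := by norm_num
  refine hΨ.map_quad_of_coeff_eq h0 ?_
  have h := (hΨ.coeff_eq_zero_iff quad_zero_mul_auxProd_mem_Pset 3).2 (by
    rw [quad_zero_mul_auxProd]
    simp only [coeff_add, coeff_C_mul, coeff_C, coeff_X, coeff_X_pow]
    norm_num)
  have h1 := hΨ.coeff_one_map_quad (.inl rfl) h0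
  have h3 : (Ψ (quad 0)).coeff 3 = 0 :=
    coeff_eq_zero_of_degree_lt ((hΨ.degree_map_quad h0).trans_lt (by norm_num))
  rw [hΨ.map_mul _ (quad_mem_Mset h0) _ auxProd_mem_Mset, hΨ.map_auxProd, auxProd_eq, coeff_mul,
    Finset.Nat.sum_antidiagonal_eq_sum_range_succ_mk] at h
  simp only [Finset.sum_range_succ, Finset.sum_range_zero, h1, h3, coeff_add, coeff_C_mul, coeff_C,
    coeff_X, coeff_X_pow] at h
  norm_num at h
  linarith

end IsSupportPreserving

theorem stmt_13 (Ψ : Polynomial ℝ → Polynomial ℝ)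
    (hmapM : ∀ q ∈ Mset, Ψ q ∈ Mset)
    (hmul : ∀ p ∈ Mset, ∀ q ∈ Mset, Ψ (p * q) = Ψ p * Ψ q)
    (hdeg : ∀ q ∈ Mset, (Ψ q).degree = q.degree)
    (hmapP : ∀ p ∈ Pset, Ψ p ∈ Pset)
    (hsupp : ∀ p ∈ Pset, ∀ k : ℕ, 0 < (Ψ p).coeff k ↔ 0 < p.coeff k)
    (hfix : Ψ (lin 1) = lin 1) :
    ∀ a : ℝ, a ∈ Set.Icc (-1 : ℝ) 1 →
      Ψ (C (2 - a)⁻¹ * (X ^ 2 - C a * X + 1)) =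
        C (2 - a)⁻¹ * (X ^ 2 - C a * X + 1) := by
  have hΨ : IsSupportPreserving Ψ := ⟨hmul, hdeg, hmapP, hsupp, hfix, hmapM⟩
  intro a ha
  rcases eq_or_ne a 0 with rfl | h
  · exact hΨ.map_quad_zero
  · exact hΨ.map_quad_of_ne_zero ha h
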